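/- The maximal ideal space of the Banach algebra ∂^{-N}A is homeomorphic to the closed polydisc cl(𝔻)^n: every nonzero multiplicative linear functional on ∂^{-N}A is evaluation at some point λ ∈ cl(𝔻)^n, and the map λ ↦ ev_λ is a homeomorphism onto the maximal ideal space with the Gelfand (weak-*) topology. -/

import Mathlib

open scoped BigOperators

/-- The open unit polydisc `𝔻ⁿ ⊆ ℂⁿ`. -/
def openPolydisc (n : ℕ) : Set (Fin n → ℂ) := { z | ∀ j, ‖z j‖ < 1 }

/-- The closed unit polydisc `cl(𝔻)ⁿ ⊆ ℂⁿ`. -/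
def closedPolydisc (n : ℕ) : Set (Fin n → ℂ) := { z | ∀ j, ‖z j‖ ≤ 1 }

/-- Membership in the polydisc algebra `A`: continuous on the closed polydisc and
holomorphic on the open polydisc. -/
def MemA (n : ℕ) (f : (Fin n → ℂ) → ℂ) : Prop :=
  ContinuousOn f (closedPolydisc n) ∧ DifferentiableOn ℂ f (openPolydisc n)

/-- The complex partial derivative with respect to the `j`-th coordinate. -/
noncomputable def pd {n : ℕ} (j : Fin n) (f : (Fin n → ℂ) → ℂ) : (Fin n → ℂ) → ℂ :=
  fun z => fderiv ℂ f z (Pi.single j 1)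

/-- The `m`-fold partial derivative with respect to the `j`-th coordinate. -/
noncomputable def pdPow {n : ℕ} (j : Fin n) : ℕ → ((Fin n → ℂ) → ℂ) → ((Fin n → ℂ) → ℂ)
  | 0 => id
  | m + 1 => fun f => pd j (pdPow j m f)

/-- The mixed partial derivative `∂^{α₁+⋯+αₙ} f / ∂z₁^{α₁} ⋯ ∂zₙ^{αₙ}`. -/
noncomputable def pdMulti {n : ℕ} (α : Fin n → ℕ) (f : (Fin n → ℂ) → ℂ) :
    (Fin n → ℂ) → ℂ :=
  (List.finRange n).foldr (fun j g => pdPow j (α j) g) f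

/-- Membership in `∂^{-N}A`: `f` lies in the polydisc algebra `A` and each of its
complex partial derivatives of total order at most `N` (computed on the open polydisc)
extends to a member of `A`. -/
def MemDN (n N : ℕ) (f : (Fin n → ℂ) → ℂ) : Prop :=
  MemA n f ∧ ∀ α : Fin n → ℕ, (∑ j, α j) ≤ N →
    ∃ g, MemA n g ∧ ∀ z ∈ openPolydisc n, g z = pdMulti α f z

/-- An element of `∂^{-N}A`, regarded as a function on the closed polydisc that is the
restriction of some global function satisfying `MemDN`. -/
def DNElem (n N : ℕ) : Type :=
  { f : ↥(closedPolydisc n) → ℂ //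
    ∃ F, MemDN n N F ∧ ∀ z : ↥(closedPolydisc n), f z = F z.1 }

/-- `φ` is a nonzero multiplicative linear functional on `∂^{-N}A`: it is additive,
multiplicative and `ℂ`-homogeneous with respect to the pointwise operations on the
closed polydisc, and not identically zero. -/
def IsChar (n N : ℕ) (φ : DNElem n N → ℂ) : Prop :=
  (∀ f g h : DNElem n N, (∀ z, h.1 z = f.1 z + g.1 z) → φ h = φ f + φ g) ∧
  (∀ f g h : DNElem n N, (∀ z, h.1 z = f.1 z * g.1 z) → φ h = φ f * φ g) ∧
  (∀ (c : ℂ) (f g : DNElem n N), (∀ z, g.1 z = c * f.1 z) → φ g = c * φ f) ∧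
  (∃ f, φ f ≠ 0)

open Metric Set

theorem norm_fderiv_le_of_forall_mem_closedBall {E : Type*} [NormedAddCommGroup E]
    [NormedSpace ℂ E] {f : E → ℂ} {z : E} {r M : ℝ} (hr : 0 < r)
    (hf : ∀ w ∈ closedBall z r, DifferentiableAt ℂ f w)
    (hM : ∀ w ∈ closedBall z r, ‖f w‖ ≤ M) : ‖fderiv ℂ f z‖ ≤ M / r := by
  have hM0 : 0 ≤ M := (norm_nonneg _).trans (hM z (mem_closedBall_self hr.le))
  refine ContinuousLinearMap.opNorm_le_bound _ (by positivity) fun v => ?_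
  rcases eq_or_ne v 0 with rfl | hv
  · simp
  have hv' : 0 < ‖v‖ := norm_pos_iff.2 hv
  have hmem : ∀ w ∈ closedBall (0 : ℂ) (r / ‖v‖), z + w • v ∈ closedBall z r := by
    intro w hw
    rw [mem_closedBall_zero_iff, le_div_iff₀ hv'] at hw
    simpa [mem_closedBall_iff_norm, norm_smul] using hw
  have hline : ∀ w : ℂ, HasDerivAt (fun w : ℂ => z + w • v) v w := fun w => by
    simpa using ((hasDerivAt_id w).smul_const v).const_add z
  have hd : ∀ w ∈ closedBall (0 : ℂ) (r / ‖v‖), HasDerivAt (fun w : ℂ => f (z + w • v))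
      (fderiv ℂ f (z + w • v) v) w := fun w hw =>
    (hf _ (hmem w hw)).hasFDerivAt.comp_hasDerivAt w (hline w)
  have key := Complex.norm_deriv_le_of_forall_mem_sphere_norm_le (div_pos hr hv')
    (DifferentiableOn.diffContOnCl (f := fun w : ℂ => f (z + w • v)) (fun w hw =>
      (hd w (closure_ball_subset_closedBall hw)).differentiableAt.differentiableWithinAt))
    (fun w hw => hM _ (hmem w (sphere_subset_closedBall hw)))
  rw [(hd 0 (mem_closedBall_self (by positivity))).deriv] at key
  simp only [zero_smul, add_zero] at key
  calc _ ≤ _ := key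
    _ = _ := by field_simp

/-- Weighted integrals of the translates and dilates of a holomorphic function are holomorphic. -/
theorem differentiableOn_integral_comp_smul_add {n : ℕ} {f : (Fin n → ℂ) → ℂ}
    {U V : Set (Fin n → ℂ)} (hU : IsOpen U) (hV : IsOpen V) (hf : DifferentiableOn ℂ f U)
    {a b : ℝ} {c s : ℝ → ℂ} {p : ℝ → Fin n → ℂ}
    (hc : Continuous c) (hs : Continuous s) (hp : Continuous p)
    (hs1 : ∀ t ∈ uIcc a b, ‖s t‖ ≤ 1)
    (hUV : ∀ z ∈ V, ∀ t ∈ uIcc a b, s t • z + p t ∈ U) :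
    DifferentiableOn ℂ (fun z => ∫ t in a..b, c t * f (s t • z + p t)) V := by
  intro x₀ hx₀
  have hK : IsCompact ((fun t => s t • x₀ + p t) '' uIcc a b) :=
    isCompact_uIcc.image (by fun_prop)
  obtain ⟨δ, hδ, hδU⟩ := hK.exists_cthickening_subset_open hU
    (by rintro _ ⟨t, ht, rfl⟩; exact hUV x₀ hx₀ t ht)
  obtain ⟨M, hM⟩ := (hK.cthickening (r := δ)).exists_bound_of_continuousOn
    (hf.continuousOn.mono hδU)
  have hball : ∀ t ∈ uIcc a b, ∀ x ∈ ball x₀ (δ / 2), closedBall (s t • x + p t) (δ / 2) ⊆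
      cthickening δ ((fun t => s t • x₀ + p t) '' uIcc a b) := by
    intro t ht x hx w hw
    refine mem_cthickening_of_dist_le w (s t • x₀ + p t) δ _ ⟨t, ht, rfl⟩ ?_
    have h1 : dist (s t • x + p t) (s t • x₀ + p t) ≤ δ / 2 := by
      rw [dist_add_right, dist_eq_norm, ← smul_sub, norm_smul]
      rw [mem_ball_iff_norm] at hx
      nlinarith [hs1 t ht, norm_nonneg (x - x₀), norm_nonneg (s t)]
    have h2 := mem_closedBall.1 hw
    linarith [dist_triangle w (s t • x + p t) (s t • x₀ + p t)]
  have hdiff : ∀ w ∈ U, DifferentiableAt ℂ f w := fun w hw => hf.differentiableAt (hU.mem_nhds hw)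
  have hcont : ∀ x ∈ V, ContinuousOn (fun t => c t * f (s t • x + p t)) (uIcc a b) := fun x hx =>
    hc.continuousOn.mul (hf.continuousOn.comp (by fun_prop) (fun t ht => hUV x hx t ht))
  have hmeas : ∀ x : Fin n → ℂ, Measurable fun t => c t • s t • fderiv ℂ f (s t • x + p t) := by
    intro x
    have h1 : Measurable fun t => fderiv ℂ f (s t • x + p t) :=
      (measurable_fderiv ℂ f).comp (Continuous.measurable (by fun_prop))
    exact hc.measurable.smul (hs.measurable.smul h1)
  have := intervalIntegral.hasFDerivAt_integral_of_dominated_of_fderiv_le (𝕜 := ℂ) (a := a) (b := b)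
    (μ := MeasureTheory.volume)
    (F := fun x t => c t * f (s t • x + p t))
    (F' := fun x t => c t • s t • fderiv ℂ f (s t • x + p t)) (x₀ := x₀)
    (bound := fun t => ‖c t‖ * (M / (δ / 2)))
    (ball_mem_nhds x₀ (half_pos hδ)) ?_ ?_ ?_ ?_ ?_ ?_
  · exact this.differentiableAt.differentiableWithinAt
  · filter_upwards [hV.mem_nhds hx₀] with x hx
    exact ((hcont x hx).intervalIntegrable).aestronglyMeasurable_restrict_uIoc
  · exact (hcont x₀ hx₀).intervalIntegrable
  · exact (hmeas x₀).aestronglyMeasurable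
  · refine Filter.Eventually.of_forall fun t ht x hx => ?_
    have ht' := uIoc_subset_uIcc ht
    have h1 := norm_fderiv_le_of_forall_mem_closedBall (f := f) (half_pos hδ)
      (fun w hw => hdiff w (hδU (hball t ht' x hx hw))) (fun w hw => hM w (hball t ht' x hx hw))
    rw [norm_smul, norm_smul]
    gcongr
    calc _ ≤ 1 * ‖fderiv ℂ f (s t • x + p t)‖ := by gcongr; exact hs1 t ht'
      _ ≤ _ := by rwa [one_mul]
  · exact Continuous.intervalIntegrable (by fun_prop) _ _
  · refine Filter.Eventually.of_forall fun t ht x hx => ?_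
    have ht' := uIoc_subset_uIcc ht
    have h1 : DifferentiableAt ℂ f (s t • x + p t) :=
      hdiff _ (hδU (hball t ht' x hx (mem_closedBall_self (half_pos hδ).le)))
    have h2 : HasFDerivAt (fun x : Fin n → ℂ => s t • x + p t)
        (s t • ContinuousLinearMap.id ℂ (Fin n → ℂ)) x :=
      ((hasFDerivAt_id x).const_smul (s t)).add_const _
    refine ((h1.hasFDerivAt.comp x h2).const_mul (c t)).congr_fderiv ?_
    ext v
    simp

/-- Directional derivatives of a holomorphic function are holomorphic. -/
theorem DifferentiableOn.fderiv_apply_complex {n : ℕ} {f : (Fin n → ℂ) → ℂ}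
    {U : Set (Fin n → ℂ)} (hU : IsOpen U) (hf : DifferentiableOn ℂ f U) (v : Fin n → ℂ) :
    DifferentiableOn ℂ (fun z => fderiv ℂ f z v) U := by
  intro z₀ hz₀
  obtain ⟨ρ, hρ, hρU⟩ := Metric.isOpen_iff.1 hU z₀ hz₀
  set r : ℝ := ρ / 2 / (‖v‖ + 1) with hr
  have hr0 : 0 < r := by positivity
  have hrv : r * ‖v‖ < ρ / 2 := by
    rw [hr, div_mul_eq_mul_div, div_lt_iff₀ (by positivity)]
    nlinarith [norm_nonneg v]
  have hmem : ∀ z ∈ ball z₀ (ρ / 2), ∀ w ∈ closedBall (0 : ℂ) r, z + w • v ∈ U := by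
    intro z hz w hw
    apply hρU
    rw [mem_ball_iff_norm] at hz ⊢
    rw [mem_closedBall_zero_iff] at hw
    have : ‖w • v‖ ≤ r * ‖v‖ := by rw [norm_smul]; gcongr
    calc ‖z + w • v - z₀‖ = ‖(z - z₀) + w • v‖ := by congr 1; abel
      _ ≤ _ := norm_add_le _ _
      _ < ρ := by linarith
  have hcircle : ∀ t, circleMap 0 r t ∈ closedBall (0 : ℂ) r := fun t =>
    sphere_subset_closedBall (circleMap_mem_sphere 0 hr0.le t)
  have hG := differentiableOn_integral_comp_smul_add hU (isOpen_ball (x := z₀) (ε := ρ / 2)) hf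
    (a := 0) (b := 2 * Real.pi)
    (c := fun t => (2 * Real.pi * Complex.I : ℂ)⁻¹ *
      (circleMap 0 r t * Complex.I * (circleMap 0 r t ^ 2)⁻¹))
    (s := fun _ => 1) (p := fun t => circleMap 0 r t • v) ?_ (by fun_prop) (by fun_prop)
    (by simp) (fun z hz t _ => by simpa using hmem z hz _ (hcircle t))
  · have heq : ∀ z ∈ ball z₀ (ρ / 2),
        fderiv ℂ f z v = Complex.cderiv r (fun w : ℂ => f (z + w • v)) 0 := fun z hz => by
      have hline : ∀ w : ℂ, HasDerivAt (fun w : ℂ => z + w • v) v w := fun w => by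
        simpa using ((hasDerivAt_id w).smul_const v).const_add z
      have hd : ∀ w ∈ closedBall (0 : ℂ) r, HasDerivAt (fun w : ℂ => f (z + w • v))
          (fderiv ℂ f (z + w • v) v) w := fun w hw =>
        (hf.differentiableAt (hU.mem_nhds (hmem z hz w hw))).hasFDerivAt.comp_hasDerivAt w (hline w)
      have hpre : IsOpen ((fun w : ℂ => z + w • v) ⁻¹' U) := hU.preimage (by fun_prop)
      have key := Complex.cderiv_eq_deriv (f := fun w : ℂ => f (z + w • v)) (z := 0) hpre
        (hf.comp (fun w _ => (hline w).differentiableAt.differentiableWithinAt) (fun _ h => h))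
        hr0 (fun w hw => hmem z hz w hw)
      rw [(hd 0 (mem_closedBall_self hr0.le)).deriv] at key
      simp only [zero_smul, add_zero] at key
      exact key.symm
    refine ((hG.congr fun z hz => ?_).differentiableAt
      (ball_mem_nhds z₀ (half_pos hρ))).differentiableWithinAt
    rw [heq z hz, Complex.cderiv, circleIntegral, ← intervalIntegral.integral_smul]
    refine intervalIntegral.integral_congr fun t _ => ?_
    simp only [deriv_circleMap, smul_eq_mul, one_smul, sub_zero]
    ring
  · have : ∀ t, circleMap 0 r t ^ 2 ≠ 0 := fun t => pow_ne_zero _ (circleMap_ne_center hr0.ne')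
    fun_prop (disch := assumption)

section PartialDerivatives

variable {n : ℕ} {U : Set (Fin n → ℂ)} {f g : (Fin n → ℂ) → ℂ}

theorem differentiableOn_pd (hU : IsOpen U) (hf : DifferentiableOn ℂ f U) (j : Fin n) :
    DifferentiableOn ℂ (pd j f) U :=
  hf.fderiv_apply_complex hU _

theorem pd_congr (hU : IsOpen U) (h : EqOn f g U) (j : Fin n) : EqOn (pd j f) (pd j g) U :=
  fun z hz => by
    simp only [pd]
    rw [Filter.EventuallyEq.fderiv_eq (h.eventuallyEq_of_mem (hU.mem_nhds hz))]

theorem fderiv_apply_eq_sum_pd (f : (Fin n → ℂ) → ℂ) (z v : Fin n → ℂ) :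
    fderiv ℂ f z v = ∑ j, v j * pd j f z := by
  conv_lhs => rw [← Finset.univ_sum_single v, map_sum]
  refine Finset.sum_congr rfl fun j _ => ?_
  rw [pd, ← smul_eq_mul, ← map_smul, ← Pi.single_smul, smul_eq_mul, mul_one]

theorem pd_comm (hU : IsOpen U) (hf : DifferentiableOn ℂ f U) (i j : Fin n) :
    EqOn (pd i (pd j f)) (pd j (pd i f)) U := by
  intro z hz
  have hfd : fderiv ℂ f = fun z => ∑ k, pd k f z •
      (ContinuousLinearMap.proj k : (Fin n → ℂ) →L[ℂ] ℂ) := by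
    funext z
    ext1 v
    rw [fderiv_apply_eq_sum_pd]
    simp [mul_comm]
  have hdiff : DifferentiableAt ℂ (fderiv ℂ f) z := by
    rw [hfd]
    exact DifferentiableAt.fun_sum fun k _ =>
      ((differentiableOn_pd hU hf k).differentiableAt (hU.mem_nhds hz)).smul_const _
  have hpd : ∀ k l : Fin n, pd k (pd l f) z =
      fderiv ℂ (fderiv ℂ f) z (Pi.single k 1) (Pi.single l 1) := by
    intro k l
    have := (hdiff.hasFDerivAt.clm_apply (hasFDerivAt_const (Pi.single l (1 : ℂ)) z)).fderiv
    change fderiv ℂ (fun z => fderiv ℂ f z (Pi.single l 1)) z (Pi.single k 1) = _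
    rw [this]
    simp
  rw [hpd, hpd]
  refine second_derivative_symmetric_of_eventually (f := f) ?_ hdiff.hasFDerivAt _ _
  filter_upwards [hU.mem_nhds hz] with y hy
  exact (hf.differentiableAt (hU.mem_nhds hy)).hasFDerivAt

theorem differentiableOn_pdPow (hU : IsOpen U) (hf : DifferentiableOn ℂ f U) (j : Fin n) (m : ℕ) :
    DifferentiableOn ℂ (pdPow j m f) U := by
  induction m with
  | zero => exact hf
  | succ m ih => exact differentiableOn_pd hU ih j

theorem pdPow_congr (hU : IsOpen U) (h : EqOn f g U) (j : Fin n) (m : ℕ) :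
    EqOn (pdPow j m f) (pdPow j m g) U := by
  induction m with
  | zero => exact h
  | succ m ih => exact pd_congr hU ih j

theorem pdPow_pd (f : (Fin n → ℂ) → ℂ) (j : Fin n) (m : ℕ) :
    pdPow j m (pd j f) = pdPow j (m + 1) f := by
  induction m with
  | zero => rfl
  | succ m ih => exact congrArg (pd j) ih

theorem pdPow_pd_comm (hU : IsOpen U) (hf : DifferentiableOn ℂ f U) (i j : Fin n) (m : ℕ) :
    EqOn (pdPow i m (pd j f)) (pd j (pdPow i m f)) U := by
  induction m with
  | zero => exact fun _ _ => rfl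
  | succ m ih => exact (pd_congr hU ih i).trans (pd_comm hU (differentiableOn_pdPow hU hf i m) i j)

theorem differentiableOn_foldr_pdPow (hU : IsOpen U) (hf : DifferentiableOn ℂ f U)
    (α : Fin n → ℕ) (l : List (Fin n)) :
    DifferentiableOn ℂ (l.foldr (fun j g => pdPow j (α j) g) f) U := by
  induction l with
  | nil => exact hf
  | cons k l ih => exact differentiableOn_pdPow hU ih k _

theorem foldr_pdPow_pd_comm (hU : IsOpen U) (hf : DifferentiableOn ℂ f U)
    (α : Fin n → ℕ) (i : Fin n) (l : List (Fin n)) :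
    EqOn (l.foldr (fun j g => pdPow j (α j) g) (pd i f))
      (pd i (l.foldr (fun j g => pdPow j (α j) g) f)) U := by
  induction l with
  | nil => exact fun _ _ => rfl
  | cons k l ih =>
    exact (pdPow_congr hU ih k _).trans
      (pdPow_pd_comm hU (differentiableOn_foldr_pdPow hU hf α l) k i _)

theorem foldr_pdPow_pd (hU : IsOpen U) (hf : DifferentiableOn ℂ f U) (α : Fin n → ℕ) (i : Fin n)
    {l : List (Fin n)} (hl : l.Nodup) (hi : i ∈ l) :
    EqOn (l.foldr (fun j g => pdPow j (α j) g) (pd i f))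
      (l.foldr (fun j g => pdPow j ((α + Pi.single i 1 : Fin n → ℕ) j) g) f) U := by
  induction l with
  | nil => simp at hi
  | cons k l ih =>
    obtain ⟨hk, hl⟩ := List.nodup_cons.1 hl
    rcases eq_or_ne k i with rfl | hki
    · have hfold : l.foldr (fun j g => pdPow j ((α + Pi.single k 1 : Fin n → ℕ) j) g) f =
          l.foldr (fun j g => pdPow j (α j) g) f := by
        refine List.foldr_ext _ _ _ fun j hj g => ?_
        rw [Pi.add_apply, Pi.single_eq_of_ne (ne_of_mem_of_not_mem hj hk), add_zero]
      rw [List.foldr_cons, List.foldr_cons, hfold, Pi.add_apply, Pi.single_eq_same, ← pdPow_pd]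
      exact pdPow_congr hU (foldr_pdPow_pd_comm hU hf α k l) k _
    · rw [List.foldr_cons, List.foldr_cons, Pi.add_apply, Pi.single_eq_of_ne hki, add_zero]
      exact pdPow_congr hU (ih hl ((List.mem_cons.1 hi).resolve_left hki.symm)) k _

theorem pdMulti_pd (hU : IsOpen U) (hf : DifferentiableOn ℂ f U) (α : Fin n → ℕ) (i : Fin n) :
    EqOn (pdMulti α (pd i f)) (pdMulti (α + Pi.single i 1) f) U :=
  foldr_pdPow_pd hU hf α i (List.nodup_finRange n) (List.mem_finRange i)

end PartialDerivatives

section Smoothness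

variable {n k : ℕ} {f g : (Fin n → ℂ) → ℂ}

theorem openPolydisc_eq_ball (n : ℕ) : openPolydisc n = ball 0 1 := by
  ext z
  rw [mem_ball_zero_iff, pi_norm_lt_iff one_pos]
  rfl

theorem closedPolydisc_eq_closedBall (n : ℕ) : closedPolydisc n = closedBall 0 1 := by
  ext z
  rw [mem_closedBall_zero_iff, pi_norm_le_iff_of_nonneg zero_le_one]
  rfl

theorem isOpen_openPolydisc (n : ℕ) : IsOpen (openPolydisc n) := by
  rw [openPolydisc_eq_ball]
  exact isOpen_ball

theorem openPolydisc_subset_closedPolydisc (n : ℕ) : openPolydisc n ⊆ closedPolydisc n :=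
  fun _ hz j => (hz j).le

theorem isCompact_closedPolydisc (n : ℕ) : IsCompact (closedPolydisc n) := by
  rw [closedPolydisc_eq_closedBall]
  exact isCompact_closedBall _ _

/-- `f` agrees on the open polydisc with a member of the polydisc algebra. -/
def ExtendsToA (n : ℕ) (f : (Fin n → ℂ) → ℂ) : Prop :=
  ∃ g, MemA n g ∧ ∀ z ∈ openPolydisc n, g z = f z

theorem MemA.add (hf : MemA n f) (hg : MemA n g) : MemA n (f + g) :=
  ⟨hf.1.add hg.1, hf.2.add hg.2⟩

theorem MemA.mul (hf : MemA n f) (hg : MemA n g) : MemA n (f * g) :=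
  ⟨hf.1.mul hg.1, hf.2.mul hg.2⟩

theorem MemA.inv (hf : MemA n f) (h0 : ∀ z ∈ closedPolydisc n, f z ≠ 0) : MemA n f⁻¹ :=
  ⟨hf.1.inv₀ h0, hf.2.inv fun z hz => h0 z (openPolydisc_subset_closedPolydisc n hz)⟩

theorem MemA.extendsToA (hf : MemA n f) : ExtendsToA n f := ⟨f, hf, fun _ _ => rfl⟩

theorem ExtendsToA.congr (hf : ExtendsToA n f) (h : EqOn f g (openPolydisc n)) :
    ExtendsToA n g := by
  obtain ⟨F, hF, hFf⟩ := hf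
  exact ⟨F, hF, fun z hz => (hFf z hz).trans (h hz)⟩

theorem ExtendsToA.differentiableOn (hf : ExtendsToA n f) :
    DifferentiableOn ℂ f (openPolydisc n) := by
  obtain ⟨F, hF, hFf⟩ := hf
  exact hF.2.congr fun z hz => (hFf z hz).symm

theorem ExtendsToA.add (hf : ExtendsToA n f) (hg : ExtendsToA n g) : ExtendsToA n (f + g) := by
  obtain ⟨F, hF, hFf⟩ := hf
  obtain ⟨G, hG, hGg⟩ := hg
  exact ⟨F + G, hF.add hG, fun z hz => by simp [hFf z hz, hGg z hz]⟩

theorem ExtendsToA.mul (hf : ExtendsToA n f) (hg : ExtendsToA n g) : ExtendsToA n (f * g) := by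
  obtain ⟨F, hF, hFf⟩ := hf
  obtain ⟨G, hG, hGg⟩ := hg
  exact ⟨F * G, hF.mul hG, fun z hz => by simp [hFf z hz, hGg z hz]⟩

/-- All iterated partial derivatives of `f` of order at most `k`, in any order of
differentiation, agree on the open polydisc with members of the polydisc algebra. -/
def SmoothUpTo (n : ℕ) : ℕ → ((Fin n → ℂ) → ℂ) → Prop
  | 0, f => ExtendsToA n f
  | k + 1, f => ExtendsToA n f ∧ ∀ j, SmoothUpTo n k (pd j f)

theorem SmoothUpTo.extendsToA (hf : SmoothUpTo n k f) : ExtendsToA n f := by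
  cases k with
  | zero => exact hf
  | succ k => exact hf.1

theorem SmoothUpTo.congr (hf : SmoothUpTo n k f) (h : EqOn f g (openPolydisc n)) :
    SmoothUpTo n k g := by
  induction k generalizing f g with
  | zero => exact ExtendsToA.congr hf h
  | succ k ih =>
    exact ⟨hf.1.congr h, fun j => ih (hf.2 j) (pd_congr (isOpen_openPolydisc n) h j)⟩

theorem SmoothUpTo.of_succ (hf : SmoothUpTo n (k + 1) f) : SmoothUpTo n k f := by
  induction k generalizing f with
  | zero => exact hf.1
  | succ k ih => exact ⟨hf.1, fun j => ih (hf.2 j)⟩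

theorem SmoothUpTo.add (hf : SmoothUpTo n k f) (hg : SmoothUpTo n k g) :
    SmoothUpTo n k (f + g) := by
  induction k generalizing f g with
  | zero => exact ExtendsToA.add hf hg
  | succ k ih =>
    refine ⟨hf.1.add hg.1, fun j => (ih (hf.2 j) (hg.2 j)).congr fun z hz => ?_⟩
    have hO := (isOpen_openPolydisc n).mem_nhds hz
    simp only [pd, Pi.add_apply]
    rw [fderiv_add (hf.1.differentiableOn.differentiableAt hO)
      (hg.1.differentiableOn.differentiableAt hO)]
    rfl

theorem SmoothUpTo.mul (hf : SmoothUpTo n k f) (hg : SmoothUpTo n k g) :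
    SmoothUpTo n k (f * g) := by
  induction k generalizing f g with
  | zero => exact ExtendsToA.mul hf hg
  | succ k ih =>
    refine ⟨hf.1.mul hg.1, fun j =>
      ((ih hf.of_succ (hg.2 j)).add (ih hg.of_succ (hf.2 j))).congr fun z hz => ?_⟩
    have hO := (isOpen_openPolydisc n).mem_nhds hz
    simp only [pd, Pi.add_apply, Pi.mul_apply]
    rw [fderiv_mul (hf.1.differentiableOn.differentiableAt hO)
      (hg.1.differentiableOn.differentiableAt hO)]
    rfl

/-- A function holomorphic on a neighbourhood of the closed polydisc is smooth up to every order. -/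
theorem DifferentiableOn.smoothUpTo {U : Set (Fin n → ℂ)} (hU : IsOpen U)
    (hn : closedPolydisc n ⊆ U) (hf : DifferentiableOn ℂ f U) (k : ℕ) : SmoothUpTo n k f := by
  have hA : ∀ {f}, DifferentiableOn ℂ f U → MemA n f := fun hf =>
    ⟨hf.continuousOn.mono hn, hf.mono ((openPolydisc_subset_closedPolydisc n).trans hn)⟩
  induction k generalizing f with
  | zero => exact (hA hf).extendsToA
  | succ k ih => exact ⟨(hA hf).extendsToA, fun j => ih (differentiableOn_pd hU hf j)⟩

theorem SmoothUpTo.const (c : ℂ) : SmoothUpTo n k fun _ => c :=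
  DifferentiableOn.smoothUpTo isOpen_univ (subset_univ _) (differentiableOn_const c) k

theorem SmoothUpTo.inv (hf : SmoothUpTo n k f) (hA : MemA n f)
    (h0 : ∀ z ∈ closedPolydisc n, f z ≠ 0) : SmoothUpTo n k f⁻¹ := by
  induction k with
  | zero => exact (hA.inv h0).extendsToA
  | succ k ih =>
    have hinv := ih hf.of_succ
    refine ⟨(hA.inv h0).extendsToA, fun j =>
      (((SmoothUpTo.const (-1)).mul (hinv.mul hinv)).mul (hf.2 j)).congr fun z hz => ?_⟩
    have hO := (isOpen_openPolydisc n).mem_nhds hz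
    have hz0 := h0 z (openPolydisc_subset_closedPolydisc n hz)
    have hd := (hf.1.differentiableOn.differentiableAt hO).hasFDerivAt
    have := ((hasDerivAt_inv hz0).comp_hasFDerivAt z hd).fderiv
    change _ = fderiv ℂ (Inv.inv ∘ f) z _
    rw [this]
    simp only [pd, Pi.mul_apply, Pi.inv_apply, smul_apply,
      smul_eq_mul]
    field_simp

theorem SmoothUpTo.pdPow {j : Fin n} {m : ℕ} (hf : SmoothUpTo n (k + m) f) :
    SmoothUpTo n k (pdPow j m f) := by
  induction m generalizing k with
  | zero => exact hf
  | succ m ih => exact (ih (k := k + 1) (by rwa [add_right_comm])).2 j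

theorem SmoothUpTo.foldr_pdPow {α : Fin n → ℕ} {l : List (Fin n)}
    (hf : SmoothUpTo n (k + (l.map α).sum) f) :
    SmoothUpTo n k (l.foldr (fun j g => _root_.pdPow j (α j) g) f) := by
  induction l generalizing k with
  | nil => simpa using hf
  | cons j l ih =>
    refine SmoothUpTo.pdPow (ih ?_)
    rwa [List.map_cons, List.sum_cons, ← add_assoc] at hf

theorem SmoothUpTo.mono {m : ℕ} (hf : SmoothUpTo n k f) (hm : m ≤ k) : SmoothUpTo n m f := by
  induction hm using Nat.decreasingInduction with
  | self => exact hf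
  | of_succ m _ ih => exact ih.of_succ

theorem smoothUpTo_of_forall_pdMulti (hf : DifferentiableOn ℂ f (openPolydisc n))
    (h : ∀ α : Fin n → ℕ, ∑ j, α j ≤ k → ExtendsToA n (pdMulti α f)) : SmoothUpTo n k f := by
  have hzero : ∀ {f : (Fin n → ℂ) → ℂ}, pdMulti 0 f = f := by
    intro f
    exact List.foldr_fixed' (fun _ => rfl) _
  induction k generalizing f with
  | zero => exact hzero (f := f) ▸ h 0 (by simp)
  | succ k ih =>
    have hO := isOpen_openPolydisc n
    refine ⟨hzero (f := f) ▸ h 0 (by simp), fun j =>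
      ih (differentiableOn_pd hO hf j) fun α hα => ?_⟩
    refine (h (α + Pi.single j 1) ?_).congr (pdMulti_pd hO hf α j).symm
    simpa [Finset.sum_add_distrib] using hα

/-- Membership in `∂^{-N}A` does not depend on the order of differentiation. -/
theorem memDN_iff {N : ℕ} : MemDN n N f ↔ MemA n f ∧ SmoothUpTo n N f := by
  refine ⟨fun h => ⟨h.1, smoothUpTo_of_forall_pdMulti h.1.2 h.2⟩, fun h => ⟨h.1, fun α hα => ?_⟩⟩
  refine (SmoothUpTo.foldr_pdPow (k := 0) (h.2.mono ?_)).extendsToA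
  rwa [zero_add, ← List.ofFn_eq_map, List.sum_ofFn]

end Smoothness

/-- Hadamard's lemma for functions holomorphic on a ball. -/
theorem exists_eq_add_sum_mul_sub {n : ℕ} {F : (Fin n → ℂ) → ℂ} {R : ℝ}
    (hF : DifferentiableOn ℂ F (ball 0 R)) {p : Fin n → ℂ} (hp : p ∈ ball 0 R) :
    ∃ g : Fin n → (Fin n → ℂ) → ℂ, (∀ j, DifferentiableOn ℂ (g j) (ball 0 R)) ∧
      ∀ z ∈ ball 0 R, F z = F p + ∑ j, (z j - p j) * g j z := by
  have hmem : ∀ z ∈ ball (0 : Fin n → ℂ) R, ∀ t ∈ uIcc (0 : ℝ) 1,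
      (t : ℂ) • z + (1 - (t : ℂ)) • p ∈ ball (0 : Fin n → ℂ) R := by
    intro z hz t ht
    rw [uIcc_of_le zero_le_one] at ht
    convert (convex_ball (0 : Fin n → ℂ) R) hz hp ht.1 (sub_nonneg.2 ht.2) (by ring) using 2 <;>
    · ext j
      simp
  have hpd := fun j => differentiableOn_pd isOpen_ball hF j
  refine ⟨fun j z => ∫ t in (0 : ℝ)..1,
    1 * pd j F ((t : ℂ) • z + (1 - (t : ℂ)) • p), fun j => ?_, fun z hz => ?_⟩
  · refine differentiableOn_integral_comp_smul_add isOpen_ball isOpen_ball (hpd j)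
      continuous_const Complex.continuous_ofReal (by fun_prop) (fun t ht => ?_) hmem
    rw [uIcc_of_le zero_le_one] at ht
    rw [Complex.norm_real, Real.norm_of_nonneg ht.1]
    exact ht.2
  · have hcont : ∀ j, ContinuousOn (fun t : ℝ => pd j F ((t : ℂ) • z + (1 - (t : ℂ)) • p))
        (uIcc 0 1) := fun j =>
      (hpd j).continuousOn.comp (by fun_prop) fun t ht => hmem z hz t ht
    have hpath : ∀ t : ℝ, HasDerivAt (fun t : ℝ => (t : ℂ) • z + (1 - (t : ℂ)) • p) (z - p) t := by
      intro t
      have h := (hasDerivAt_id t).ofReal_comp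
      exact ((h.smul_const z).add ((h.const_sub 1).smul_const p)).congr_deriv
        (by simp [sub_eq_add_neg])
    have hFTC := intervalIntegral.integral_eq_sub_of_hasDerivAt (a := 0) (b := 1)
      (f := fun t : ℝ => F ((t : ℂ) • z + (1 - (t : ℂ)) • p))
      (f' := fun t : ℝ => ∑ j, (z j - p j) * pd j F ((t : ℂ) • z + (1 - (t : ℂ)) • p))
      (fun t ht => ?_) ?_
    · rw [intervalIntegral.integral_finsetSum fun j _ =>
        ((hcont j).intervalIntegrable).const_mul _] at hFTC
      simp only [intervalIntegral.integral_const_mul] at hFTC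
      simp only [one_mul]
      rw [hFTC]
      simp
    · have hd := (hF.differentiableAt (isOpen_ball.mem_nhds (hmem z hz t ht))).hasFDerivAt
      have h1 := (hd.restrictScalars ℝ).comp_hasDerivAt t (hpath t)
      exact h1.congr_deriv (fderiv_apply_eq_sum_pd F _ (z - p))
    · exact (continuousOn_finsetSum _ fun j _ => continuousOn_const.mul
        (hcont j)).intervalIntegrable

section Characters

variable {n N : ℕ}

theorem MemDN.add {f g : (Fin n → ℂ) → ℂ} (hf : MemDN n N f) (hg : MemDN n N g) :
    MemDN n N (f + g) :=
  memDN_iff.2 ⟨hf.1.add hg.1, (memDN_iff.1 hf).2.add (memDN_iff.1 hg).2⟩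

theorem MemDN.mul {f g : (Fin n → ℂ) → ℂ} (hf : MemDN n N f) (hg : MemDN n N g) :
    MemDN n N (f * g) :=
  memDN_iff.2 ⟨hf.1.mul hg.1, (memDN_iff.1 hf).2.mul (memDN_iff.1 hg).2⟩

theorem MemDN.inv {f : (Fin n → ℂ) → ℂ} (hf : MemDN n N f)
    (h0 : ∀ z ∈ closedPolydisc n, f z ≠ 0) : MemDN n N f⁻¹ :=
  memDN_iff.2 ⟨hf.1.inv h0, (memDN_iff.1 hf).2.inv hf.1 h0⟩

theorem DifferentiableOn.memDN {f : (Fin n → ℂ) → ℂ} {U : Set (Fin n → ℂ)} (hU : IsOpen U)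
    (hn : closedPolydisc n ⊆ U) (hf : DifferentiableOn ℂ f U) : MemDN n N f :=
  memDN_iff.2 ⟨⟨hf.continuousOn.mono hn,
    hf.mono ((openPolydisc_subset_closedPolydisc n).trans hn)⟩, hf.smoothUpTo hU hn N⟩

theorem Differentiable.memDN {f : (Fin n → ℂ) → ℂ} (hf : Differentiable ℂ f) : MemDN n N f :=
  hf.differentiableOn.memDN isOpen_univ (subset_univ _)

theorem MemDN.const (c : ℂ) : MemDN n N fun _ => c := (differentiable_const c).memDN

theorem MemDN.sub {f g : (Fin n → ℂ) → ℂ} (hf : MemDN n N f) (hg : MemDN n N g) :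
    MemDN n N (f - g) := by
  convert hf.add ((MemDN.const (-1)).mul hg) using 1
  ext z
  simp [sub_eq_add_neg]

/-- The element of `∂^{-N}A` defined by a function on `ℂⁿ`. -/
def MemDN.toElem {F : (Fin n → ℂ) → ℂ} (hF : MemDN n N F) : DNElem n N :=
  ⟨fun z => F z.1, F, hF, fun _ => rfl⟩

theorem DNElem.exists_toElem (f : DNElem n N) : ∃ F, ∃ hF : MemDN n N F, f = hF.toElem := by
  obtain ⟨F, hF, hfF⟩ := f.2
  exact ⟨F, hF, Subtype.ext (funext hfF)⟩

theorem DNElem.continuous (f : DNElem n N) : Continuous f.1 := by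
  obtain ⟨F, hF, rfl⟩ := f.exists_toElem
  exact continuousOn_iff_continuous_domRestrict.1 hF.1.1

theorem isChar_eval (p : closedPolydisc n) : IsChar n N fun f => f.1 p :=
  ⟨fun _ _ _ h => h p, fun _ _ _ h => h p, fun _ _ _ h => h p,
    (MemDN.const 1).toElem, one_ne_zero⟩

theorem memDN_coord (j : Fin n) : MemDN n N fun z => z j :=
  Differentiable.memDN (by fun_prop)

theorem closedPolydisc_subset_ball {R : ℝ} (hR : 1 < R) : closedPolydisc n ⊆ ball 0 R := by
  rw [closedPolydisc_eq_closedBall]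
  exact closedBall_subset_ball hR

namespace IsChar

variable {φ : DNElem n N → ℂ} {F G : (Fin n → ℂ) → ℂ}

theorem map_mul (hφ : IsChar n N φ) (hF : MemDN n N F) (hG : MemDN n N G) :
    φ (hF.mul hG).toElem = φ hF.toElem * φ hG.toElem := hφ.2.1 _ _ _ fun _ => rfl

theorem map_const (hφ : IsChar n N φ) (c : ℂ) : φ (MemDN.const c).toElem = c := by
  obtain ⟨-, hmul, hsmul, f, hf⟩ := hφ
  have h1 : φ (MemDN.const 1).toElem = 1 :=
    mul_left_cancel₀ hf (by rw [mul_one, ← hmul f _ f fun z => (mul_one _).symm])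
  rw [hsmul c (MemDN.const 1).toElem _ fun z => (mul_one c).symm, h1, mul_one]

theorem map_sub (hφ : IsChar n N φ) (hF : MemDN n N F) (hG : MemDN n N G) :
    φ (hF.sub hG).toElem = φ hF.toElem - φ hG.toElem := by
  rw [eq_sub_iff_add_eq]
  exact (hφ.1 _ _ _ fun z => (sub_add_cancel (F z.1) (G z.1)).symm).symm

/-- A character of `∂^{-N}A` takes each function to one of its values. -/
theorem exists_eq_apply (hφ : IsChar n N φ) (hF : MemDN n N F) :
    ∃ z ∈ closedPolydisc n, φ hF.toElem = F z := by
  by_contra! h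
  have hG := hF.sub (MemDN.const (φ hF.toElem))
  have h0 : ∀ z ∈ closedPolydisc n, F z - φ hF.toElem ≠ 0 := fun z hz h' =>
    h z hz (sub_eq_zero.1 h').symm
  have hone : φ (MemDN.const 1).toElem = φ hG.toElem * φ (hG.inv h0).toElem :=
    hφ.2.1 _ _ _ fun z => (mul_inv_cancel₀ (h0 z.1 z.2)).symm
  rw [hφ.map_const, hφ.map_sub hF (MemDN.const _), hφ.map_const, sub_self, zero_mul] at hone
  exact one_ne_zero hone

theorem norm_sub_le (hφ : IsChar n N φ) (hF : MemDN n N F) (hG : MemDN n N G) {ε : ℝ}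
    (h : ∀ z ∈ closedPolydisc n, ‖F z - G z‖ ≤ ε) : ‖φ hF.toElem - φ hG.toElem‖ ≤ ε := by
  obtain ⟨z, hz, hz'⟩ := hφ.exists_eq_apply (hF.sub hG)
  rw [← hφ.map_sub, hz']
  exact h z hz

theorem map_sum_mul_eq_zero (hφ : IsChar n N φ) {ι : Type*} (s : Finset ι)
    {a b : ι → (Fin n → ℂ) → ℂ} (ha : ∀ i, MemDN n N (a i)) (hb : ∀ i, MemDN n N (b i))
    (h0 : ∀ i, φ (ha i).toElem = 0) (hF : MemDN n N F)
    (hFs : ∀ z ∈ closedPolydisc n, F z = ∑ i ∈ s, a i z * b i z) : φ hF.toElem = 0 := by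
  classical
  induction s using Finset.induction_on generalizing F with
  | empty =>
    rw [← hφ.map_const 0]
    exact congrArg φ (Subtype.ext (funext fun z => hFs z.1 z.2))
  | insert i s hi ih =>
    have hrest : MemDN n N (F - a i * b i) := hF.sub ((ha i).mul (hb i))
    have hs := ih hrest fun z hz => by
      simp [hFs z hz, Finset.sum_insert hi]
    rwa [hφ.map_sub hF ((ha i).mul (hb i)), hφ.map_mul (ha i) (hb i), h0, zero_mul, sub_zero] at hs

theorem coord_mem_closedPolydisc (hφ : IsChar n N φ) :
    (fun j => φ (memDN_coord j).toElem) ∈ closedPolydisc n := fun j => by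
  obtain ⟨z, hz, h⟩ := hφ.exists_eq_apply (memDN_coord j)
  simpa only [h] using hz j

theorem apply_eq_of_differentiableOn_ball (hφ : IsChar n N φ) {R : ℝ} (hR : 1 < R)
    (hFR : DifferentiableOn ℂ F (ball 0 R)) (hF : MemDN n N F) :
    φ hF.toElem = F fun j => φ (memDN_coord j).toElem := by
  set p : Fin n → ℂ := fun j => φ (memDN_coord j).toElem
  have hsub := closedPolydisc_subset_ball (n := n) hR
  obtain ⟨g, hg, hgF⟩ := exists_eq_add_sum_mul_sub hFR (hsub hφ.coord_mem_closedPolydisc)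
  have h := hφ.map_sum_mul_eq_zero Finset.univ
    (fun j => (memDN_coord j).sub (MemDN.const (p j)))
    (fun j => (hg j).memDN isOpen_ball hsub)
    (fun j => by rw [hφ.map_sub (memDN_coord j) (MemDN.const _), hφ.map_const, sub_self])
    (hF.sub (MemDN.const (F p)))
    (fun z hz => by
      change F z - F p = ∑ j, (z j - p j) * g j z
      rw [hgF z (hsub hz)]
      exact add_sub_cancel_left _ _)
  rwa [hφ.map_sub hF (MemDN.const _), hφ.map_const, sub_eq_zero] at h

theorem apply_eq (hφ : IsChar n N φ) (hF : MemDN n N F) :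
    φ hF.toElem = F fun j => φ (memDN_coord j).toElem := by
  set p : Fin n → ℂ := fun j => φ (memDN_coord j).toElem
  have hp : p ∈ closedPolydisc n := hφ.coord_mem_closedPolydisc
  refine eq_of_forall_dist_le fun ε hε => ?_
  obtain ⟨δ, hδ, hδF⟩ := Metric.uniformContinuousOn_iff_le.1
    ((isCompact_closedPolydisc n).uniformContinuousOn_of_continuous hF.1.1) (ε / 2) (half_pos hε)
  obtain ⟨r, hr0, hr1, hrδ⟩ : ∃ r : ℝ, 0 < r ∧ r < 1 ∧ 1 - r ≤ δ :=
    ⟨max (1 / 2) (1 - δ), by positivity, by simp [hδ]; norm_num, by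
      linarith [le_max_right (1 / 2) (1 - δ)]⟩
  have hmap : MapsTo (fun z : Fin n → ℂ => (r : ℂ) • z) (ball 0 r⁻¹) (openPolydisc n) := by
    intro z hz
    rw [mem_ball_zero_iff] at hz
    rw [openPolydisc_eq_ball, mem_ball_zero_iff, norm_smul, Complex.norm_real,
      Real.norm_of_nonneg hr0.le, ← mul_inv_cancel₀ hr0.ne']
    gcongr
  have hG : DifferentiableOn ℂ (fun z => F ((r : ℂ) • z)) (ball 0 r⁻¹) :=
    hF.1.2.comp (by fun_prop) hmap
  have hR : 1 < r⁻¹ := (one_lt_inv₀ hr0).2 hr1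
  have hGm : MemDN n N fun z => F ((r : ℂ) • z) :=
    hG.memDN isOpen_ball (closedPolydisc_subset_ball hR)
  have hclose : ∀ z ∈ closedPolydisc n, ‖F z - F ((r : ℂ) • z)‖ ≤ ε / 2 := fun z hz => by
    rw [← dist_eq_norm]
    refine hδF z hz _ (openPolydisc_subset_closedPolydisc n
      (hmap (closedPolydisc_subset_ball hR hz))) ?_
    rw [closedPolydisc_eq_closedBall, mem_closedBall_zero_iff] at hz
    calc dist z ((r : ℂ) • z) = ‖((1 - r : ℝ) : ℂ) • z‖ := by
          rw [dist_eq_norm]; congr 1; push_cast; module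
      _ = (1 - r) * ‖z‖ := by
          rw [norm_smul, Complex.norm_real, Real.norm_of_nonneg (by linarith)]
      _ ≤ (1 - r) * 1 := by gcongr
      _ ≤ δ := by linarith
  have h1 := hφ.norm_sub_le hF hGm hclose
  rw [hφ.apply_eq_of_differentiableOn_ball hR hG hGm, ← dist_eq_norm] at h1
  have h2 := hclose p hp
  rw [← dist_eq_norm, dist_comm] at h2
  linarith [dist_triangle (φ hF.toElem) (F ((r : ℂ) • p)) (F p)]

end IsChar

end Characters

/-- The maximal ideal space of `∂^{-N}A`, i.e. the space of nonzero multiplicative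
linear functionals equipped with the weak-* (pointwise convergence) topology, is
homeomorphic to the closed polydisc, via `λ ↦ (evaluation at λ)`. -/
theorem maximalIdealSpace_DN_homeo_closedPolydisc (n N : ℕ) (hN : 0 < N) :
    ∃ e : ↥(closedPolydisc n) ≃ₜ { φ : DNElem n N → ℂ // IsChar n N φ },
      ∀ (lam : ↥(closedPolydisc n)) (f : DNElem n N), (e lam).1 f = f.1 lam := by
  have : CompactSpace (closedPolydisc n) :=
    isCompact_iff_compactSpace.1 (isCompact_closedPolydisc n)
  let ev : closedPolydisc n → { φ : DNElem n N → ℂ // IsChar n N φ } := fun p =>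
    ⟨fun f => f.1 p, isChar_eval p⟩
  have hcont : Continuous ev :=
    Continuous.subtype_mk (continuous_pi fun f => f.continuous) _
  have hbij : Function.Bijective ev := by
    refine ⟨fun p q h => Subtype.ext (funext fun j => ?_), fun φ => ?_⟩
    · exact congrFun (congrArg Subtype.val h) (memDN_coord j).toElem
    · refine ⟨⟨_, φ.2.coord_mem_closedPolydisc⟩, Subtype.ext (funext fun f => ?_)⟩
      obtain ⟨F, hF, rfl⟩ := f.exists_toElem
      exact (φ.2.apply_eq hF).symm
  exact ⟨hcont.homeoOfEquivCompactToT2 (f := Equiv.ofBijective ev hbij), fun _ _ => rfl⟩
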